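/- arXiv:1801.07930 — 2 statements merged into one kernel-verified Lean document; each statement's English description precedes it below -/
import Mathlib

section
/- Let n be a positive integer and let j, i be positive integers with 1 ≤ j < i ≤ n. Then in ℚ[x_1, …, x_n] one has f_{i−1,j} = Σ_{k=1}^{i−j} (−1)^{k−1} 𝔖_{w_k^{(i,j)}}, where 𝔖_{w_k^{(i,j)}} is the Schubert polynomial of the permutation w_k^{(i,j)} ∈ S_n. -/
open MvPolynomial Finset

/-- The product of simple transpositions `s_a s_{a-1} ⋯ s_b` (descending indices),
where `s_r` interchanges `r` and `r+1`; the empty product (when `a < b`) is the identity. -/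
def sdesc (a b : ℕ) : Equiv.Perm ℕ :=
  (((List.range' b (a + 1 - b)).reverse).map (fun r => Equiv.swap r (r + 1))).prod

/-- The product of simple transpositions `s_a s_{a+1} ⋯ s_b` (ascending indices);
the empty product (when `b < a`) is the identity. -/
def sasc (a b : ℕ) : Equiv.Perm ℕ :=
  ((List.range' a (b + 1 - a)).map (fun r => Equiv.swap r (r + 1))).prod

/-- The permutation `w_k^{(i,j)} = (s_{i-k} s_{i-k-1} ⋯ s_j)(s_{i-k+1} s_{i-k+2} ⋯ s_{i-1})`,
regarded as a permutation of `ℕ` (supported on `{1, …, n}`). -/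
def wkij (i j k : ℕ) : Equiv.Perm ℕ := sdesc (i - k) j * sasc (i - k + 1) (i - 1)

/-- The longest element `w_0 = [n, n-1, …, 1]` of `S_n`, as a permutation of `ℕ`. -/
def revPerm (n : ℕ) : Equiv.Perm ℕ :=
  Function.Involutive.toPerm (fun x => if 1 ≤ x ∧ x ≤ n then n + 1 - x else x)
    (fun x => by simp only; split_ifs <;> omega)

/-- The polynomial `f_{i,j} = Σ_{k=1}^{j} (Π_{ℓ=j+1}^{i} (x_k - x_ℓ)) x_k` in `ℚ[x_1, …]`. -/
noncomputable def fpoly (i j : ℕ) : MvPolynomial ℕ ℚ :=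
  ∑ k ∈ Finset.Icc 1 j, (∏ l ∈ Finset.Icc (j + 1) i, (X k - X l)) * X k

/-- `IsDividedDifference r f g` says that `g` is the divided difference `∂_r f`. -/
def IsDividedDifference (r : ℕ) (f g : MvPolynomial ℕ ℚ) : Prop :=
  f - rename (⇑(Equiv.swap r (r + 1))) f = (X r - X (r + 1)) * g

/-- The families of polynomials satisfying the defining properties of the Schubert polynomials
of `S_n`. -/
structure IsSchubertFamily (n : ℕ) (S : Equiv.Perm ℕ → MvPolynomial ℕ ℚ) : Prop where
  top : S (revPerm n) = ∏ r ∈ Finset.Icc 1 (n - 1), X r ^ (n - r)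
  descent : ∀ w : Equiv.Perm ℕ, (∀ x, x ∉ Finset.Icc 1 n → w x = x) →
    ∀ r, 1 ≤ r → r < n → w (r + 1) < w r →
      IsDividedDifference r (S w) (S (w * Equiv.swap r (r + 1)))

section Polynomials

lemma X_sub_X_succ_ne_zero (r : ℕ) : (X r - X (r + 1) : MvPolynomial ℕ ℚ) ≠ 0 := by
  rw [sub_ne_zero]
  intro h
  have := X_injective h
  omega

lemma isHomogeneous_X_sub_X_succ (r : ℕ) :
    (X r - X (r + 1) : MvPolynomial ℕ ℚ).IsHomogeneous 1 :=
  (isHomogeneous_X _ _).sub (isHomogeneous_X _ _)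

lemma IsHomogeneous.of_mul_left {a b : MvPolynomial ℕ ℚ} {k d : ℕ} (ha : a.IsHomogeneous k)
    (ha0 : a ≠ 0) (hab : (a * b).IsHomogeneous (k + d)) : b.IsHomogeneous d := by
  let _ := gradedAlgebra (σ := ℕ) (R := ℚ)
  have key : ∀ e, homogeneousComponent (k + e) (a * b) = a * homogeneousComponent e b := by
    intro e
    have := DirectSum.coe_decompose_mul_add_of_left_mem (homogeneousSubmodule ℕ ℚ)
      (i := k) (j := e) (b := b) ((mem_homogeneousSubmodule k a).2 ha)
    rwa [← MvPolynomial.decomposition.decompose'_apply,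
      ← MvPolynomial.decomposition.decompose'_apply]
  rw [← sum_homogeneousComponent b]
  refine IsHomogeneous.sum _ _ _ fun e _ => ?_
  by_cases h : e = d
  · exact h ▸ homogeneousComponent_isHomogeneous _ _
  · have h0 : homogeneousComponent (k + e) (a * b) = 0 := by
      rw [homogeneousComponent_of_mem hab, if_neg (by omega)]
    rw [key] at h0
    rw [(mul_eq_zero.1 h0).resolve_left ha0]
    exact isHomogeneous_zero _ _ _

namespace IsDividedDifference

variable {r : ℕ} {f g f' g' : MvPolynomial ℕ ℚ}

lemma zero_iff : IsDividedDifference r f 0 ↔ rename (⇑(Equiv.swap r (r + 1))) f = f := by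
  unfold IsDividedDifference
  rw [mul_zero, sub_eq_zero, eq_comm]

lemma sub (h : IsDividedDifference r f g) (h' : IsDividedDifference r f' g') :
    IsDividedDifference r (f - f') (g - g') := by
  unfold IsDividedDifference at *
  rw [map_sub]
  linear_combination h - h'

lemma invariant_mul (c : MvPolynomial ℕ ℚ) (hc : rename (⇑(Equiv.swap r (r + 1))) c = c)
    (h : IsDividedDifference r f g) : IsDividedDifference r (c * f) (c * g) := by
  unfold IsDividedDifference at *
  rw [map_mul, hc]
  linear_combination c * h

lemma sum {ι : Type*} (s : Finset ι) {f g : ι → MvPolynomial ℕ ℚ}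
    (h : ∀ a ∈ s, IsDividedDifference r (f a) (g a)) :
    IsDividedDifference r (∑ a ∈ s, f a) (∑ a ∈ s, g a) := by
  unfold IsDividedDifference at *
  rw [map_sum, ← Finset.sum_sub_distrib, Finset.mul_sum]
  exact Finset.sum_congr rfl h

lemma unique (h : IsDividedDifference r f g) (h' : IsDividedDifference r f g') : g = g' :=
  mul_left_cancel₀ (X_sub_X_succ_ne_zero r) (h.symm.trans h')

lemma rename_eq (h : IsDividedDifference r f g) :
    rename (⇑(Equiv.swap r (r + 1))) g = g := by
  unfold IsDividedDifference at h
  have h2 := congrArg (rename (⇑(Equiv.swap r (r + 1)))) h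
  have hinv : (⇑(Equiv.swap r (r + 1)) ∘ ⇑(Equiv.swap r (r + 1))) = id := by
    ext x
    simp
  rw [map_sub, rename_rename, hinv, rename_id_apply, map_mul, map_sub, rename_X, rename_X,
    Equiv.swap_apply_left, Equiv.swap_apply_right] at h2
  refine mul_left_cancel₀ (X_sub_X_succ_ne_zero r) ?_
  linear_combination h + h2

lemma isHomogeneous {d : ℕ} (h : IsDividedDifference r f g) (hf : f.IsHomogeneous (1 + d)) :
    g.IsHomogeneous d := by
  refine IsHomogeneous.of_mul_left (isHomogeneous_X_sub_X_succ r) (X_sub_X_succ_ne_zero r) ?_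
  rw [← h]
  exact hf.sub hf.rename_isHomogeneous

lemma degreeOf_add_le (h : IsDividedDifference r f g) (hg : g ≠ 0) (m : ℕ) :
    degreeOf m (X r - X (r + 1) : MvPolynomial ℕ ℚ) + degreeOf m g ≤
      max (degreeOf m f) (degreeOf (Equiv.swap r (r + 1) m) f) := by
  rw [← degreeOf_mul_eq (X_sub_X_succ_ne_zero r) hg, ← h]
  refine (degreeOf_sub_le _ _ _).trans (max_le_max le_rfl ?_)
  have := degreeOf_rename_of_injective (p := f) (Equiv.swap r (r + 1)).injective
    (Equiv.swap r (r + 1) m)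
  rw [Equiv.swap_apply_self] at this
  exact this.le

end IsDividedDifference

/-- The staircase bound `deg_{x_m} f ≤ n - m` for `m ≥ 1`, with `x_0` absent. -/
def StaircaseBounded (n : ℕ) (f : MvPolynomial ℕ ℚ) : Prop :=
  degreeOf 0 f = 0 ∧ ∀ m, 1 ≤ m → degreeOf m f ≤ n - m

lemma one_le_degreeOf_X_sub_X {a b : ℕ} (hab : a ≠ b) :
    1 ≤ degreeOf a (X a - X b : MvPolynomial ℕ ℚ) := by
  have h : (Finsupp.single a 1) ∈ (X a - X b : MvPolynomial ℕ ℚ).support := by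
    simp [mem_support_iff, coeff_sub, coeff_X, Finsupp.single_left_inj, hab.symm]
  simpa using monomial_le_degreeOf a h

lemma StaircaseBounded.of_isDividedDifference {n r : ℕ} {f g : MvPolynomial ℕ ℚ} (hr : 1 ≤ r)
    (hrn : r < n) (hf : StaircaseBounded n f) (h : IsDividedDifference r f g) :
    StaircaseBounded n g := by
  obtain ⟨h0, hb⟩ := hf
  by_cases hg : g = 0
  · subst hg
    exact ⟨degreeOf_zero _, fun m _ => by rw [degreeOf_zero]; omega⟩
  have key := h.degreeOf_add_le hg
  have hr' := hb r hr
  have hr1 := hb (r + 1) (by omega)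
  have one_r : 1 ≤ degreeOf r (X r - X (r + 1) : MvPolynomial ℕ ℚ) :=
    one_le_degreeOf_X_sub_X (by omega)
  have one_r1 : 1 ≤ degreeOf (r + 1) (X r - X (r + 1) : MvPolynomial ℕ ℚ) := by
    rw [← neg_sub, degreeOf_neg]
    exact one_le_degreeOf_X_sub_X (by omega)
  refine ⟨?_, fun m hm => ?_⟩
  · have := key 0
    rw [Equiv.swap_apply_of_ne_of_ne (by omega) (by omega), max_self] at this
    omega
  · have k := key m
    have hm' := hb m hm
    rcases eq_or_ne m r with rfl | h1
    · rw [Equiv.swap_apply_left] at k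
      omega
    · rcases eq_or_ne m (r + 1) with rfl | h2
      · rw [Equiv.swap_apply_right] at k
        omega
      · rw [Equiv.swap_apply_of_ne_of_ne h1 h2, max_self] at k
        omega

lemma StaircaseBounded.mem_supported {n : ℕ} {f : MvPolynomial ℕ ℚ} (hf : StaircaseBounded n f) :
    f ∈ supported ℚ (Set.Ico 1 n) := by
  rw [MvPolynomial.mem_supported]
  intro m hm
  have hpos : 0 < degreeOf m f := by
    rw [degreeOf_def]
    exact Multiset.count_pos.2 (by simpa [vars_def] using hm)
  rcases Nat.eq_zero_or_pos m with rfl | h1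
  · have := hf.1
    omega
  · have := hf.2 m h1
    exact ⟨h1, by omega⟩

lemma eq_zero_of_mem_supported_of_symmetric {n : ℕ} {D : MvPolynomial ℕ ℚ}
    (hs : D ∈ supported ℚ (Set.Ico 1 n))
    (hr : ∀ r, 1 ≤ r → r < n → IsDividedDifference r D 0) (hc : constantCoeff D = 0) :
    D = 0 := by
  rw [mem_supported] at hs
  have up : ∀ r ∈ D.vars, r + 1 ∈ D.vars := by
    intro r h
    have hb := hs h
    have hsym := IsDividedDifference.zero_iff.1 (hr r hb.1 hb.2)
    have hd := degreeOf_rename_of_injective (p := D) (Equiv.swap r (r + 1)).injective r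
    rw [Equiv.swap_apply_left, hsym] at hd
    have hpos : 0 < degreeOf r D := by
      rw [degreeOf_def]
      exact Multiset.count_pos.2 (by simpa [vars_def] using h)
    rw [← hd, degreeOf_def] at hpos
    simpa [vars_def] using Multiset.count_pos.1 hpos
  have hempty : D.vars = ∅ := by
    by_contra hne
    obtain ⟨r, h⟩ := Finset.nonempty_iff_ne_empty.2 hne
    have h1 := up _ (D.vars.max'_mem ⟨r, h⟩)
    have := D.vars.le_max' _ h1
    omega
  rw [vars_eq_empty_iff_eq_C] at hempty
  rw [hempty, ← constantCoeff_eq, hc, C_0]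

end Polynomials

section Permutations

/-- `w` is a permutation of `{1, …, n}`, extended by the identity. -/
def SupportedOn (n : ℕ) (w : Equiv.Perm ℕ) : Prop := ∀ x, x ∉ Finset.Icc 1 n → w x = x

/-- The inversions of `w` among positions in `{1, …, n}`. -/
def inversions (n : ℕ) (w : Equiv.Perm ℕ) : Finset (ℕ × ℕ) :=
  (Finset.Icc 1 n ×ˢ Finset.Icc 1 n).filter fun p => p.1 < p.2 ∧ w p.2 < w p.1

lemma mem_inversions {n a b : ℕ} {w : Equiv.Perm ℕ} : (a, b) ∈ inversions n w ↔
    ((1 ≤ a ∧ a ≤ n) ∧ 1 ≤ b ∧ b ≤ n) ∧ a < b ∧ w b < w a := by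
  simp [inversions]

lemma card_inversions_le (n : ℕ) (w : Equiv.Perm ℕ) :
    (inversions n w).card ≤ ∑ r ∈ Finset.Icc 1 (n - 1), (n - r) := by
  have hsub : inversions n w ⊆
      (Finset.Icc 1 (n - 1)).biUnion fun a => (Finset.Ioc a n).image fun b => (a, b) := by
    rintro ⟨a, b⟩ h
    rw [mem_inversions] at h
    simp only [Finset.mem_biUnion, Finset.mem_image, Finset.mem_Icc, Finset.mem_Ioc]
    exact ⟨a, by omega, b, by omega, rfl⟩
  refine (Finset.card_le_card hsub).trans (Finset.card_biUnion_le.trans ?_)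
  refine Finset.sum_le_sum fun a _ => Finset.card_image_le.trans ?_
  rw [Nat.card_Ioc]

lemma revPerm_apply (n x : ℕ) : revPerm n x = if 1 ≤ x ∧ x ≤ n then n + 1 - x else x := rfl

lemma SupportedOn.mul_swap {n r : ℕ} {w : Equiv.Perm ℕ} (hw : SupportedOn n w) (hr : 1 ≤ r)
    (hrn : r < n) : SupportedOn n (w * Equiv.swap r (r + 1)) := by
  intro x hx
  have hx' := hx
  rw [Finset.mem_Icc] at hx'
  rw [Equiv.Perm.mul_apply, Equiv.swap_apply_of_ne_of_ne (by omega) (by omega), hw x hx]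

lemma SupportedOn.apply_mem {n : ℕ} {w : Equiv.Perm ℕ} (hw : SupportedOn n w) {x : ℕ}
    (hx : x ∈ Finset.Icc 1 n) : w x ∈ Finset.Icc 1 n := by
  by_contra h
  have := w.injective (hw _ h)
  exact h (by rwa [this])

lemma supportedOn_revPerm {m n : ℕ} (h : m ≤ n) : SupportedOn n (revPerm m) := by
  intro x hx
  rw [Finset.mem_Icc] at hx
  exact if_neg (by omega)

lemma card_inversions_mul_swap {n r : ℕ} {w : Equiv.Perm ℕ} (hr : 1 ≤ r) (hrn : r < n)
    (h : w r < w (r + 1)) :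
    (inversions n (w * Equiv.swap r (r + 1))).card = (inversions n w).card + 1 := by
  have himage : inversions n (w * Equiv.swap r (r + 1)) = insert (r, r + 1)
      ((inversions n w).map ((Equiv.swap r (r + 1)).prodCongr
        (Equiv.swap r (r + 1))).toEmbedding) := by
    ext ⟨a, b⟩
    simp only [mem_inversions, Finset.mem_insert, Finset.mem_map_equiv, Equiv.prodCongr_symm,
      Equiv.symm_swap, Equiv.prodCongr_apply, Prod.map_apply, Equiv.Perm.mul_apply, Prod.mk.injEq]
    rcases eq_or_ne a r with ha | ha <;> rcases eq_or_ne a (r + 1) with ha' | ha' <;>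
    rcases eq_or_ne b r with hb | hb <;> rcases eq_or_ne b (r + 1) with hb' | hb'
    all_goals first | omega | skip
    all_goals subst_vars
    all_goals simp (disch := first | assumption | omega) only [Equiv.swap_apply_left,
      Equiv.swap_apply_right, Equiv.swap_apply_of_ne_of_ne, and_self, true_or, iff_true]
    all_goals omega
  rw [himage, Finset.card_insert_of_notMem, Finset.card_map]
  simp [inversions, Finset.mem_map_equiv]

lemma exists_ascent {n : ℕ} {w : Equiv.Perm ℕ} (hw : SupportedOn n w) (hne : w ≠ revPerm n) :
    ∃ r, 1 ≤ r ∧ r < n ∧ w r < w (r + 1) := by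
  by_contra! hcon
  have hdesc : ∀ r, 1 ≤ r → r < n → w (r + 1) < w r := fun r h1 h2 =>
    lt_of_le_of_ne (hcon r h1 h2) fun he => by
      have := w.injective he
      omega
  have hmem : ∀ x, 1 ≤ x → x ≤ n → 1 ≤ w x ∧ w x ≤ n := fun x h1 h2 =>
    Finset.mem_Icc.1 (hw.apply_mem (Finset.mem_Icc.2 ⟨h1, h2⟩))
  have upper : ∀ x, 1 ≤ x → x ≤ n → w x ≤ n + 1 - x := by
    intro x h1
    induction x, h1 using Nat.le_induction with
    | base => intro h; have := hmem 1 le_rfl h; omega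
    | succ x hx ih => intro h; have := hdesc x hx (by omega); have := ih (by omega); omega
  have lower : ∀ k, k < n → k + 1 ≤ w (n - k) := by
    intro k
    induction k with
    | zero => intro h; have := hmem n (by omega) le_rfl; simpa using this.1
    | succ k ih =>
      intro h
      have h1 := hdesc (n - (k + 1)) (by omega) (by omega)
      rw [show n - (k + 1) + 1 = n - k by omega] at h1
      have := ih (by omega)
      omega
  refine hne (Equiv.ext fun x => ?_)
  by_cases hx : 1 ≤ x ∧ x ≤ n
  · have h1 := upper x hx.1 hx.2
    have h2 := lower (n - x) (by omega)
    rw [show n - (n - x) = x by omega] at h2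
    refine Eq.trans ?_ (if_pos hx).symm
    omega
  · rw [hw x (by rwa [Finset.mem_Icc]), supportedOn_revPerm le_rfl x (by rwa [Finset.mem_Icc])]

lemma prod_ascending_swaps_apply (a m x : ℕ) :
    ((List.range' a m).map (fun r => Equiv.swap r (r + 1))).prod x =
      if x = a + m then a else if a ≤ x ∧ x < a + m then x + 1 else x := by
  induction m generalizing x with
  | zero =>
    simp only [List.range'_zero, List.map_nil, List.prod_nil, Equiv.Perm.one_apply]
    split_ifs <;> omega
  | succ m ih =>
    rw [List.range'_1_concat, List.map_append, List.prod_append, Equiv.Perm.mul_apply]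
    simp only [List.map_cons, List.map_nil, List.prod_singleton, ih, Equiv.swap_apply_def]
    split_ifs <;> omega

lemma prod_descending_swaps_apply (b m x : ℕ) :
    (((List.range' b m).reverse).map (fun r => Equiv.swap r (r + 1))).prod x =
      if x = b then b + m else if b < x ∧ x ≤ b + m then x - 1 else x := by
  induction m generalizing x with
  | zero =>
    simp only [List.range'_zero, List.reverse_nil, List.map_nil, List.prod_nil,
      Equiv.Perm.one_apply]
    split_ifs <;> omega
  | succ m ih =>
    rw [List.range'_1_concat, List.reverse_append, List.map_append, List.prod_append,
      Equiv.Perm.mul_apply, ih]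
    simp only [List.reverse_singleton, List.map_cons, List.map_nil, List.prod_singleton,
      Equiv.swap_apply_def]
    split_ifs <;> omega

lemma sasc_succ (t : ℕ) : sasc 1 (t + 1) = sasc 1 t * Equiv.swap (t + 1) (t + 1 + 1) := by
  simp only [sasc, Nat.add_sub_cancel]
  rw [List.range'_1_concat, List.map_append, List.prod_append]
  simp [add_comm]

lemma wkij_apply {i j k : ℕ} (hk : 1 ≤ k) (hki : k + j ≤ i) (x : ℕ) :
    wkij i j k x = if x < j then x else if x = j then i - k + 1 else if x ≤ i - k then x - 1
      else if x < i then x + 1 else if x = i then i - k else x := by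
  simp only [wkij, sdesc, sasc, Equiv.Perm.mul_apply, prod_ascending_swaps_apply,
    prod_descending_swaps_apply]
  split_ifs <;> omega

lemma supportedOn_wkij {n i j k : ℕ} (hj : 1 ≤ j) (hk : 1 ≤ k) (hki : k + j ≤ i) (hi : i ≤ n) :
    SupportedOn n (wkij i j k) := by
  intro x hx
  rw [Finset.mem_Icc] at hx
  rw [wkij_apply hk hki]
  split_ifs <;> omega

lemma wkij_mul_swap_left {i j k : ℕ} (hk : 1 ≤ k) (hki : k + j < i) :
    wkij i j k * Equiv.swap j (j + 1) = wkij i (j + 1) k := by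
  ext x
  rw [Equiv.Perm.mul_apply, wkij_apply hk hki.le, wkij_apply hk (by omega), Equiv.swap_apply_def]
  split_ifs <;> omega

lemma wkij_mul_swap_right {i j k : ℕ} (hk : 1 ≤ k) (hki : k + j ≤ i) :
    wkij (i + 1) j (k + 1) * Equiv.swap i (i + 1) = wkij i j k := by
  ext x
  rw [Equiv.Perm.mul_apply, wkij_apply (by omega) (by omega), wkij_apply hk hki,
    Equiv.swap_apply_def]
  split_ifs <;> omega

lemma wkij_succ_self (j : ℕ) : wkij (j + 1) j 1 * Equiv.swap j (j + 1) = 1 := by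
  ext x
  rw [Equiv.Perm.mul_apply, wkij_apply le_rfl (by omega), Equiv.swap_apply_def,
    Equiv.Perm.one_apply]
  split_ifs <;> omega

end Permutations

namespace IsSchubertFamily

variable {n : ℕ} {S : Equiv.Perm ℕ → MvPolynomial ℕ ℚ}

lemma apply_revPerm_mul_sasc (hS : IsSchubertFamily n S) {m t : ℕ} (hm : m + 1 ≤ n) (ht : t ≤ m)
    (h : S (revPerm (m + 1)) = ∏ r ∈ Finset.Icc 1 m, X r ^ (m + 1 - r)) :
    S (revPerm (m + 1) * sasc 1 t) =
      (∏ r ∈ Finset.Icc 1 t, X r ^ (m - r)) * ∏ r ∈ Finset.Icc (t + 1) m, X r ^ (m + 1 - r) := by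
  induction t with
  | zero => simpa [sasc] using h
  | succ t ih =>
    have ih := ih (by omega)
    have hsupp : SupportedOn n (revPerm (m + 1) * sasc 1 t) := by
      intro x hx
      have hx' := Finset.mem_Icc.not.1 hx
      rw [Equiv.Perm.mul_apply, sasc, prod_ascending_swaps_apply, if_neg (by omega),
        if_neg (by omega), supportedOn_revPerm hm x hx]
    have v1 : (revPerm (m + 1) * sasc 1 t) (t + 1) = m + 1 := by
      rw [Equiv.Perm.mul_apply, sasc, prod_ascending_swaps_apply, if_pos (by omega)]
      rw [revPerm_apply, if_pos (by omega)]
      omega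
    have v2 : (revPerm (m + 1) * sasc 1 t) (t + 1 + 1) = m - t := by
      rw [Equiv.Perm.mul_apply, sasc, prod_ascending_swaps_apply, if_neg (by omega),
        if_neg (by omega)]
      rw [revPerm_apply, if_pos (by omega)]
      omega
    have hd := hS.descent _ hsupp (t + 1) (by omega) (by omega) (by rw [v1, v2]; omega)
    rw [mul_assoc, ← sasc_succ] at hd
    refine hd.unique ?_
    have split1 : ∏ r ∈ Finset.Icc (t + 1) m, (X r : MvPolynomial ℕ ℚ) ^ (m + 1 - r) =
        X (t + 1) ^ (m - t) * ∏ r ∈ Finset.Icc (t + 2) m, X r ^ (m + 1 - r) := by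
      rw [← Finset.insert_Icc_add_one_left_eq_Icc ht, Finset.prod_insert (by simp)]
      congr 2
      omega
    have split2 : ∏ r ∈ Finset.Icc (t + 2) m, (X r : MvPolynomial ℕ ℚ) ^ (m + 1 - r) =
        X (t + 1 + 1) ^ (m - t - 1) * ∏ r ∈ Finset.Icc (t + 3) m, X r ^ (m + 1 - r) := by
      rcases Nat.lt_or_ge m (t + 2) with h2 | h2
      · rw [Finset.Icc_eq_empty (by omega), Finset.Icc_eq_empty (by omega),
          show m - t - 1 = 0 by omega]
        simp
      · rw [← Finset.insert_Icc_add_one_left_eq_Icc h2, Finset.prod_insert (by simp)]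
        congr 2
        omega
    rw [ih, Finset.prod_Icc_succ_top (by omega), split1, show t + 1 + 1 = t + 2 from rfl, split2]
    have inv1 : rename (⇑(Equiv.swap (t + 1) (t + 1 + 1)))
        (∏ r ∈ Finset.Icc 1 t, (X r : MvPolynomial ℕ ℚ) ^ (m - r)) =
        ∏ r ∈ Finset.Icc 1 t, X r ^ (m - r) := by
      rw [map_prod]
      refine Finset.prod_congr rfl fun r hr => ?_
      rw [Finset.mem_Icc] at hr
      rw [map_pow, rename_X, Equiv.swap_apply_of_ne_of_ne (by omega) (by omega)]
    have inv2 : rename (⇑(Equiv.swap (t + 1) (t + 1 + 1)))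
        (∏ r ∈ Finset.Icc (t + 3) m, (X r : MvPolynomial ℕ ℚ) ^ (m + 1 - r)) =
        ∏ r ∈ Finset.Icc (t + 3) m, X r ^ (m + 1 - r) := by
      rw [map_prod]
      refine Finset.prod_congr rfl fun r hr => ?_
      rw [Finset.mem_Icc] at hr
      rw [map_pow, rename_X, Equiv.swap_apply_of_ne_of_ne (by omega) (by omega)]
    unfold IsDividedDifference
    simp only [map_mul, map_pow, rename_X, Equiv.swap_apply_left, Equiv.swap_apply_right, inv1,
      inv2]
    obtain ⟨e, rfl⟩ : ∃ e, m = t + 1 + e := ⟨m - (t + 1), by omega⟩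
    rw [show t + 1 + e - t = e + 1 by omega, show t + 1 + e - (t + 1) = e by omega,
      Nat.add_sub_cancel]
    ring

lemma apply_revPerm (hS : IsSchubertFamily n S) {m : ℕ} (hm : m ≤ n) :
    S (revPerm m) = ∏ r ∈ Finset.Icc 1 (m - 1), X r ^ (m - r) := by
  induction hm using Nat.decreasingInduction with
  | self => exact hS.top
  | of_succ m hmn ih =>
    have h := hS.apply_revPerm_mul_sasc hmn le_rfl (by simpa using ih)
    have hperm : revPerm (m + 1) * sasc 1 m = revPerm m := by
      ext x
      rw [Equiv.Perm.mul_apply, sasc, prod_ascending_swaps_apply]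
      simp only [revPerm_apply]
      split_ifs <;> omega
    rw [hperm, Finset.Icc_eq_empty (a := m + 1) (by omega), Finset.prod_empty, mul_one] at h
    rw [h]
    rcases Nat.eq_zero_or_pos m with rfl | hpos
    · simp
    · obtain ⟨e, rfl⟩ : ∃ e, m = e + 1 := ⟨m - 1, by omega⟩
      rw [Finset.prod_Icc_succ_top (by omega)]
      simp

lemma apply_one (hS : IsSchubertFamily n S) : S 1 = 1 := by
  have h := hS.apply_revPerm (Nat.zero_le n)
  have hperm : revPerm 0 = 1 := by
    ext x
    exact if_neg (by omega)
  simpa [hperm] using h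

lemma isDividedDifference_of_ascent (hS : IsSchubertFamily n S) {w : Equiv.Perm ℕ}
    (hw : SupportedOn n w) {r : ℕ} (hr : 1 ≤ r) (hrn : r < n) (h : w r < w (r + 1)) :
    IsDividedDifference r (S (w * Equiv.swap r (r + 1))) (S w) := by
  have := hS.descent _ (hw.mul_swap hr hrn) r hr hrn (by simpa using h)
  rwa [mul_assoc, Equiv.swap_mul_self, mul_one] at this

lemma isDividedDifference_zero (hS : IsSchubertFamily n S) {w : Equiv.Perm ℕ}
    (hw : SupportedOn n w) {r : ℕ} (hr : 1 ≤ r) (hrn : r < n) (h : w r < w (r + 1)) :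
    IsDividedDifference r (S w) 0 :=
  IsDividedDifference.zero_iff.2 (hS.isDividedDifference_of_ascent hw hr hrn h).rename_eq

/-- Induction from the longest element down to all permutations, along ascents. -/
lemma _root_.SupportedOn.induction {P : Equiv.Perm ℕ → Prop} (htop : P (revPerm n))
    (hstep : ∀ w r, SupportedOn n w → 1 ≤ r → r < n → w r < w (r + 1) →
      P (w * Equiv.swap r (r + 1)) → P w) {w : Equiv.Perm ℕ} (hw : SupportedOn n w) : P w := by
  induction hk : (∑ r ∈ Finset.Icc 1 (n - 1), (n - r)) - (inversions n w).card
    using Nat.strong_induction_on generalizing w with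
  | _ k ih =>
    by_cases hne : w = revPerm n
    · exact hne ▸ htop
    obtain ⟨r, hr, hrn, hasc⟩ := exists_ascent hw hne
    have hcard := card_inversions_mul_swap hr hrn hasc
    have := card_inversions_le n (w * Equiv.swap r (r + 1))
    exact hstep w r hw hr hrn hasc (ih _ (by omega) (hw.mul_swap hr hrn) rfl)

lemma staircaseBounded (hS : IsSchubertFamily n S) {w : Equiv.Perm ℕ} (hw : SupportedOn n w) :
    StaircaseBounded n (S w) := by
  refine SupportedOn.induction (P := fun w => StaircaseBounded n (S w)) ?_
    (fun w r hw hr hrn hasc ih => ?_) hw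
  · have hdeg : ∀ m, degreeOf m (S (revPerm n)) ≤
        ∑ r ∈ Finset.Icc 1 (n - 1), if m = r then n - r else 0 := by
      intro m
      rw [hS.top]
      refine (degreeOf_prod_le _ _ _).trans (Finset.sum_le_sum fun r _ => ?_)
      refine (degreeOf_pow_le _ _ _).trans ?_
      rw [degreeOf_X]
      split_ifs <;> simp
    simp only [Finset.sum_ite_eq] at hdeg
    refine ⟨?_, fun m _ => ?_⟩
    · simpa using hdeg 0
    · refine (hdeg m).trans ?_
      split_ifs <;> simp
  · exact ih.of_isDividedDifference hr hrn (hS.isDividedDifference_of_ascent hw hr hrn hasc)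

lemma isHomogeneous (hS : IsSchubertFamily n S) {w : Equiv.Perm ℕ} (hw : SupportedOn n w) :
    ∀ d, d + (inversions n (revPerm n)).card =
      (inversions n w).card + ∑ r ∈ Finset.Icc 1 (n - 1), (n - r) → (S w).IsHomogeneous d := by
  refine SupportedOn.induction (P := fun w => ∀ d, d + (inversions n (revPerm n)).card =
    (inversions n w).card + ∑ r ∈ Finset.Icc 1 (n - 1), (n - r) → (S w).IsHomogeneous d)
    (fun d hd => ?_) (fun w r hw hr hrn hasc ih d hd => ?_) hw
  · obtain rfl : d = ∑ r ∈ Finset.Icc 1 (n - 1), (n - r) := by omega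
    rw [hS.top]
    exact IsHomogeneous.prod _ _ _ fun r _ => isHomogeneous_X_pow r (n - r)
  · refine (hS.isDividedDifference_of_ascent hw hr hrn hasc).isHomogeneous (ih _ ?_)
    rw [card_inversions_mul_swap hr hrn hasc]
    omega

lemma constantCoeff_eq_zero (hS : IsSchubertFamily n S) {w : Equiv.Perm ℕ}
    (hw : SupportedOn n w) (hne : (inversions n w).Nonempty) : constantCoeff (S w) = 0 := by
  have hpos := hne.card_pos
  have htop := card_inversions_le n (revPerm n)
  have h := hS.isHomogeneous hw
    ((inversions n w).card + ∑ r ∈ Finset.Icc 1 (n - 1), (n - r) -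
      (inversions n (revPerm n)).card) (by omega)
  rw [constantCoeff_eq]
  refine h.coeff_eq_zero ?_
  rw [map_zero]
  omega

end IsSchubertFamily

section TargetPolynomials

lemma fpoly_mem_supported {n i j : ℕ} (hji : j ≤ i) (hin : i < n) :
    fpoly i j ∈ supported ℚ (Set.Ico 1 n) := by
  have hX : ∀ m, 1 ≤ m → m < n → (X m : MvPolynomial ℕ ℚ) ∈ supported ℚ (Set.Ico 1 n) :=
    fun m h1 h2 => X_mem_supported.2 ⟨h1, h2⟩
  refine Subalgebra.sum_mem _ fun k hk => Subalgebra.mul_mem _ (Subalgebra.prod_mem _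
    fun l hl => Subalgebra.sub_mem _ ?_ ?_) ?_
  all_goals rw [Finset.mem_Icc] at hk
  · exact hX k hk.1 (by omega)
  · rw [Finset.mem_Icc] at hl
    exact hX l (by omega) (by omega)
  · exact hX k hk.1 (by omega)

lemma constantCoeff_fpoly (i j : ℕ) : constantCoeff (fpoly i j) = 0 := by
  simp [fpoly, map_sum]

lemma isDividedDifference_fpoly_self (j : ℕ) (hj : 1 ≤ j) :
    IsDividedDifference j (fpoly j j) 1 := by
  obtain ⟨j, rfl⟩ : ∃ e, j = e + 1 := ⟨j - 1, by omega⟩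
  have hinv : ∑ k ∈ Finset.Icc 1 j, (X (Equiv.swap (j + 1) (j + 1 + 1) k) : MvPolynomial ℕ ℚ) =
      ∑ k ∈ Finset.Icc 1 j, X k := by
    refine Finset.sum_congr rfl fun k hk => ?_
    rw [Finset.mem_Icc] at hk
    rw [Equiv.swap_apply_of_ne_of_ne (by omega) (by omega)]
  simp only [IsDividedDifference, fpoly, Finset.Icc_eq_empty (show ¬ j + 1 + 1 ≤ j + 1 by omega),
    Finset.prod_empty, one_mul, map_sum, rename_X]
  rw [Finset.sum_Icc_succ_top (by omega), Finset.sum_Icc_succ_top (by omega), hinv,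
    Equiv.swap_apply_left]
  ring

lemma isDividedDifference_fpoly_left {i j : ℕ} (hj : 1 ≤ j) (hji : j < i) :
    IsDividedDifference j (fpoly i j) (fpoly i (j + 1)) := by
  obtain ⟨j, rfl⟩ : ∃ e, j = e + 1 := ⟨j - 1, by omega⟩
  have hprod : ∀ y, ∏ l ∈ Finset.Icc (j + 1 + 1) i, (y - X l : MvPolynomial ℕ ℚ) =
      (y - X (j + 1 + 1)) * ∏ l ∈ Finset.Icc (j + 1 + 1 + 1) i, (y - X l) := by
    intro y
    rw [← Finset.insert_Icc_add_one_left_eq_Icc (show j + 1 + 1 ≤ i by omega),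
      Finset.prod_insert (by simp)]
  have hinv : ∀ y, ∏ l ∈ Finset.Icc (j + 1 + 1 + 1) i,
      (y - X (Equiv.swap (j + 1) (j + 1 + 1) l) : MvPolynomial ℕ ℚ) =
        ∏ l ∈ Finset.Icc (j + 1 + 1 + 1) i, (y - X l) := by
    intro y
    refine Finset.prod_congr rfl fun l hl => ?_
    rw [Finset.mem_Icc] at hl
    rw [Equiv.swap_apply_of_ne_of_ne (by omega) (by omega)]
  have hsum : ∀ F : MvPolynomial ℕ ℚ → MvPolynomial ℕ ℚ,
      ∑ k ∈ Finset.Icc 1 j, F (X (Equiv.swap (j + 1) (j + 1 + 1) k)) =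
        ∑ k ∈ Finset.Icc 1 j, F (X k) := by
    intro F
    refine Finset.sum_congr rfl fun k hk => ?_
    rw [Finset.mem_Icc] at hk
    rw [Equiv.swap_apply_of_ne_of_ne (by omega) (by omega)]
  simp only [IsDividedDifference, fpoly, hprod, map_sum, map_mul, map_sub, map_prod, rename_X,
    Equiv.swap_apply_right, hinv]
  rw [Finset.sum_Icc_succ_top (b := j) (by omega), Finset.sum_Icc_succ_top (b := j) (by omega),
    Finset.sum_Icc_succ_top (b := j + 1) (by omega), Finset.sum_Icc_succ_top (b := j) (by omega),
    hsum fun y => (y - X (j + 1)) * (∏ l ∈ Finset.Icc (j + 1 + 1 + 1) i, (y - X l)) * y,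
    Equiv.swap_apply_left]
  have hdiff : ∑ k ∈ Finset.Icc 1 j, (X k - X (j + 1 + 1)) *
        (∏ l ∈ Finset.Icc (j + 1 + 1 + 1) i, (X k - X l)) * X k -
      ∑ k ∈ Finset.Icc 1 j, (X k - X (j + 1)) *
        (∏ l ∈ Finset.Icc (j + 1 + 1 + 1) i, (X k - X l)) * X k =
      (X (j + 1) - X (j + 1 + 1) : MvPolynomial ℕ ℚ) * ∑ k ∈ Finset.Icc 1 j,
        (∏ l ∈ Finset.Icc (j + 1 + 1 + 1) i, (X k - X l)) * X k := by
    rw [← Finset.sum_sub_distrib, Finset.mul_sum]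
    exact Finset.sum_congr rfl fun k _ => by ring
  linear_combination hdiff

lemma isDividedDifference_fpoly_right {i j : ℕ} (hji : j ≤ i) :
    IsDividedDifference (i + 1) (fpoly (i + 1) j) (-fpoly i j) := by
  simp only [IsDividedDifference, fpoly, map_sum, map_mul, map_prod, map_sub, rename_X]
  rw [← Finset.sum_sub_distrib, mul_neg, Finset.mul_sum, ← Finset.sum_neg_distrib]
  refine Finset.sum_congr rfl fun k hk => ?_
  rw [Finset.mem_Icc] at hk
  rw [Finset.prod_Icc_succ_top (by omega), Finset.prod_Icc_succ_top (by omega),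
    Equiv.swap_apply_of_ne_of_ne (x := k) (by omega) (by omega), Equiv.swap_apply_left]
  have hinv : ∏ l ∈ Finset.Icc (j + 1) i,
      (X k - X (Equiv.swap (i + 1) (i + 1 + 1) l) : MvPolynomial ℕ ℚ) =
        ∏ l ∈ Finset.Icc (j + 1) i, (X k - X l) := by
    refine Finset.prod_congr rfl fun l hl => ?_
    rw [Finset.mem_Icc] at hl
    rw [Equiv.swap_apply_of_ne_of_ne (by omega) (by omega)]
  rw [hinv]
  ring

lemma isDividedDifference_fpoly_zero {i j r : ℕ} (hr : 1 ≤ r) (hj : r ≠ j) (hi : r ≠ i) :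
    IsDividedDifference r (fpoly i j) 0 := by
  set s := Equiv.swap r (r + 1) with hs
  have hmem : ∀ a b, r + 1 ≠ a → r ≠ b → ∀ x, x ∈ Finset.Icc a b ↔ s x ∈ Finset.Icc a b := by
    intro a b h1 h2 x
    rw [hs, Equiv.swap_apply_def]
    simp only [Finset.mem_Icc]
    split_ifs <;> omega
  rw [IsDividedDifference.zero_iff]
  simp only [fpoly, map_sum, map_mul, map_prod, map_sub, rename_X]
  refine Finset.sum_equiv s (hmem 1 j (by omega) hj) fun k _ => ?_
  congr 1
  exact Finset.prod_equiv s (hmem (j + 1) i (by omega) hi) fun l _ => rfl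

end TargetPolynomials

section Expansion

variable {n : ℕ} {S : Equiv.Perm ℕ → MvPolynomial ℕ ℚ}

lemma isDividedDifference_alternating_sum {r m : ℕ} {f g : ℕ → MvPolynomial ℕ ℚ}
    (h : ∀ k < m, IsDividedDifference r (f k) (g k)) :
    IsDividedDifference r (∑ k ∈ Finset.range m, (-1) ^ k * f k)
      (∑ k ∈ Finset.range m, (-1) ^ k * g k) :=
  IsDividedDifference.sum _ fun k hk =>
    (h k (Finset.mem_range.1 hk)).invariant_mul _ (by simp)

/-- The alternating sum of Schubert polynomials attached to the pair `(j + d + 1, j)`. -/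
noncomputable def schubertSum (S : Equiv.Perm ℕ → MvPolynomial ℕ ℚ) (d j : ℕ) :
    MvPolynomial ℕ ℚ :=
  ∑ k ∈ Finset.range (d + 1), (-1) ^ k * S (wkij (j + d + 1) j (k + 1))

namespace IsSchubertFamily

lemma isDividedDifference_schubertSum_self (hS : IsSchubertFamily n S) {j : ℕ} (hj : 1 ≤ j)
    (hn : j + 1 ≤ n) : IsDividedDifference j (schubertSum S 0 j) 1 := by
  have h := hS.descent _ (supportedOn_wkij hj le_rfl (by omega) hn : SupportedOn n
    (wkij (j + 1) j 1)) j hj (by omega) (by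
      rw [wkij_apply le_rfl (by omega), wkij_apply le_rfl (by omega)]
      split_ifs <;> omega)
  rw [wkij_succ_self, hS.apply_one] at h
  simpa [schubertSum] using h

lemma isDividedDifference_schubertSum_left (hS : IsSchubertFamily n S) {j d : ℕ} (hj : 1 ≤ j)
    (hn : j + d + 2 ≤ n) :
    IsDividedDifference j (schubertSum S (d + 1) j) (schubertSum S d (j + 1)) := by
  have h := isDividedDifference_alternating_sum (r := j) (m := d + 1 + 1)
    (f := fun k => S (wkij (j + (d + 1) + 1) j (k + 1)))
    (g := fun k => if k < d + 1 then S (wkij (j + 1 + d + 1) (j + 1) (k + 1)) else 0) ?_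
  · rw [Finset.sum_range_succ (fun k => _ * ite _ _ _), if_neg (lt_irrefl _), mul_zero,
      add_zero] at h
    convert! h using 1
    refine Finset.sum_congr rfl fun k hk => ?_
    rw [if_pos (Finset.mem_range.1 hk)]
  · intro k hk
    have hw : SupportedOn n (wkij (j + (d + 1) + 1) j (k + 1)) :=
      supportedOn_wkij hj (by omega) (by omega) (by omega)
    split_ifs with hkd
    · have := hS.descent _ hw j hj (by omega) (by
        rw [wkij_apply (by omega) (by omega), wkij_apply (by omega) (by omega)]
        split_ifs <;> omega)
      rw [wkij_mul_swap_left (by omega) (by omega)] at this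
      rwa [show j + 1 + d + 1 = j + (d + 1) + 1 by omega]
    · refine hS.isDividedDifference_zero hw hj (by omega) ?_
      rw [wkij_apply (by omega) (by omega), wkij_apply (by omega) (by omega)]
      split_ifs <;> omega

lemma isDividedDifference_schubertSum_right (hS : IsSchubertFamily n S) {j d : ℕ} (hj : 1 ≤ j)
    (hn : j + d + 2 ≤ n) :
    IsDividedDifference (j + d + 1) (schubertSum S (d + 1) j) (-schubertSum S d j) := by
  have h := isDividedDifference_alternating_sum (r := j + d + 1) (m := d + 1 + 1)
    (f := fun k => S (wkij (j + (d + 1) + 1) j (k + 1)))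
    (g := fun k => if k = 0 then 0 else S (wkij (j + d + 1) j k)) ?_
  · rw [Finset.sum_range_succ' (fun k => _ * ite _ _ _), if_pos rfl, mul_zero, add_zero] at h
    convert! h using 1
    rw [schubertSum, ← Finset.sum_neg_distrib]
    refine Finset.sum_congr rfl fun k _ => ?_
    rw [if_neg (by omega)]
    ring
  · intro k hk
    have hw : SupportedOn n (wkij (j + (d + 1) + 1) j (k + 1)) :=
      supportedOn_wkij hj (by omega) (by omega) (by omega)
    split_ifs with hk0
    · refine hS.isDividedDifference_zero hw (by omega) (by omega) ?_
      rw [wkij_apply (by omega) (by omega), wkij_apply (by omega) (by omega)]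
      split_ifs <;> omega
    · have := hS.descent _ hw (j + d + 1) (by omega) (by omega) (by
        rw [wkij_apply (by omega) (by omega), wkij_apply (by omega) (by omega)]
        split_ifs <;> omega)
      rwa [← add_assoc, wkij_mul_swap_right (by omega) (by omega), add_assoc j d 1] at this

lemma isDividedDifference_schubertSum_zero (hS : IsSchubertFamily n S) {j d r : ℕ} (hj : 1 ≤ j)
    (hn : j + d + 1 ≤ n) (hr : 1 ≤ r) (hrn : r < n) (hrj : r ≠ j) (hrd : r ≠ j + d) :
    IsDividedDifference r (schubertSum S d j) 0 := by
  have h := isDividedDifference_alternating_sum (r := r) (m := d + 1)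
    (f := fun k => S (wkij (j + d + 1) j (k + 1))) (g := fun _ => 0) fun k hk => by
      refine hS.isDividedDifference_zero (supportedOn_wkij hj (by omega) (by omega) hn) hr hrn ?_
      rw [wkij_apply (by omega) (by omega), wkij_apply (by omega) (by omega)]
      split_ifs <;> omega
  simpa [schubertSum] using h

lemma schubertSum_mem_supported (hS : IsSchubertFamily n S) {j d : ℕ} (hj : 1 ≤ j)
    (hn : j + d + 1 ≤ n) : schubertSum S d j ∈ supported ℚ (Set.Ico 1 n) := by
  refine Subalgebra.sum_mem _ fun k hk => ?_
  rw [Finset.mem_range] at hk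
  exact Subalgebra.mul_mem _
    (Subalgebra.pow_mem _ (Subalgebra.neg_mem _ (Subalgebra.one_mem _)) _)
    (hS.staircaseBounded (supportedOn_wkij hj (by omega) (by omega) hn)).mem_supported

lemma constantCoeff_schubertSum (hS : IsSchubertFamily n S) {j d : ℕ} (hj : 1 ≤ j)
    (hn : j + d + 1 ≤ n) : constantCoeff (schubertSum S d j) = 0 := by
  rw [schubertSum, map_sum]
  refine Finset.sum_eq_zero fun k hk => ?_
  rw [Finset.mem_range] at hk
  rw [map_mul, hS.constantCoeff_eq_zero (supportedOn_wkij hj (by omega) (by omega) hn)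
    ⟨(j, j + d + 1), ?_⟩, mul_zero]
  rw [mem_inversions, wkij_apply (by omega) (by omega), wkij_apply (by omega) (by omega)]
  split_ifs <;> omega

lemma fpoly_eq_schubertSum (hS : IsSchubertFamily n S) {d j : ℕ} (hj : 1 ≤ j)
    (hn : j + d + 1 ≤ n) : fpoly (j + d) j = schubertSum S d j := by
  induction d generalizing j with
  | zero =>
    refine sub_eq_zero.1 (eq_zero_of_mem_supported_of_symmetric (n := n)
      (Subalgebra.sub_mem _ (fpoly_mem_supported (by omega) (by omega))
        (hS.schubertSum_mem_supported hj hn)) (fun r hr hrn => ?_) ?_)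
    · by_cases hrj : r = j
      · subst hrj
        simpa using (isDividedDifference_fpoly_self r hr).sub
          (hS.isDividedDifference_schubertSum_self hr hn)
      · simpa using (isDividedDifference_fpoly_zero hr hrj hrj).sub
          (hS.isDividedDifference_schubertSum_zero hj hn hr hrn hrj (by simpa using hrj))
    · rw [map_sub, constantCoeff_fpoly, hS.constantCoeff_schubertSum hj hn, sub_zero]
  | succ d ih =>
    refine sub_eq_zero.1 (eq_zero_of_mem_supported_of_symmetric (n := n)
      (Subalgebra.sub_mem _ (fpoly_mem_supported (by omega) (by omega))
        (hS.schubertSum_mem_supported hj hn)) (fun r hr hrn => ?_) ?_)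
    · by_cases hrj : r = j
      · subst hrj
        have h := (isDividedDifference_fpoly_left (i := r + (d + 1)) hr (by omega)).sub
          (hS.isDividedDifference_schubertSum_left hr hn)
        rwa [← ih (j := r + 1) (by omega) (by omega), show r + 1 + d = r + (d + 1) by omega,
          sub_self] at h
      · by_cases hrd : r = j + d + 1
        · subst hrd
          have h := (isDividedDifference_fpoly_right (i := j + d) (j := j) (by omega)).sub
            (hS.isDividedDifference_schubertSum_right hj hn)
          rwa [← ih hj (by omega), sub_self] at h
        · simpa [← add_assoc] using (isDividedDifference_fpoly_zero hr hrj hrd).sub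
            (hS.isDividedDifference_schubertSum_zero hj hn hr hrn hrj hrd)
    · rw [map_sub, constantCoeff_fpoly, hS.constantCoeff_schubertSum hj hn, sub_zero]

end IsSchubertFamily

end Expansion

/-- Theorem 1 of the paper.  For `1 ≤ j < i ≤ n`,
`f_{i-1,j} = Σ_{k=1}^{i-j} (-1)^{k-1} 𝔖_{w_k^{(i,j)}}` in `ℚ[x_1, …, x_n]`.
The Schubert polynomials are encoded as any family `S` satisfying their defining
properties: `S w₀ = x_1^{n-1} x_2^{n-2} ⋯ x_{n-1}` and, for `w ∈ S_n` (i.e. `w`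
fixing everything outside `{1, …, n}`) with `w(r) > w(r+1)` (`1 ≤ r ≤ n-1`),
`∂_r(S w) = S (w s_r)`, stated multiplicatively as
`S w - s_r(S w) = (x_r - x_{r+1}) · S (w s_r)`. -/
theorem stmt0 (n i j : ℕ) (hj : 1 ≤ j) (hji : j < i) (hin : i ≤ n)
    (S : Equiv.Perm ℕ → MvPolynomial ℕ ℚ)
    (hS0 : S (revPerm n) = ∏ r ∈ Finset.Icc 1 (n - 1), X r ^ (n - r))
    (hSrec : ∀ w : Equiv.Perm ℕ, (∀ x, x ∉ Finset.Icc 1 n → w x = x) →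
      ∀ r, 1 ≤ r → r < n → w (r + 1) < w r →
        S w - rename (⇑(Equiv.swap r (r + 1))) (S w)
          = (X r - X (r + 1)) * S (w * Equiv.swap r (r + 1))) :
    fpoly (i - 1) j
      = ∑ k ∈ Finset.Icc 1 (i - j), (-1 : MvPolynomial ℕ ℚ) ^ (k - 1) * S (wkij i j k) := by
  have hS : IsSchubertFamily n S := ⟨hS0, hSrec⟩
  obtain ⟨d, rfl⟩ : ∃ d, i = j + d + 1 := ⟨i - j - 1, by omega⟩
  rw [Nat.add_sub_cancel, hS.fpoly_eq_schubertSum hj hin, schubertSum,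
    show j + d + 1 - j = d + 1 by omega, ← Finset.Ico_add_one_right_eq_Icc,
    Finset.sum_Ico_eq_sum_range]
  refine Finset.sum_congr rfl fun k _ => ?_
  rw [Nat.add_sub_cancel_left, add_comm 1 k]
end

section
/- Let n > 2. Then in ℤ[x_1, …, x_n] one has (𝔖_{s_1} + 𝔖_{s_{n−2}} − 𝔖_{s_{n−1}}) · ( Σ_{k=1}^{n−2} (−1)^{k−1} 𝔖_{w_k^{(n−1,1)}} ) = Σ_{k=1}^{n−1} (−1)^{k−1} 𝔖_{w_k^{(n,1)}}, where all permutations are regarded as elements of S_n. -/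
open MvPolynomial Finset

/-- The cycle `s_a s_{a+1} ⋯ s_{a+t-1}`; right multiplication by it moves the entry in
position `a` to position `a + t`. -/
def cyc : ℕ → ℕ → Equiv.Perm ℕ
  | _, 0 => 1
  | a, t + 1 => Equiv.swap a (a + 1) * cyc (a + 1) t

lemma cyc_apply (t : ℕ) : ∀ a x : ℕ, cyc a t x =
    if a ≤ x ∧ x < a + t then x + 1 else if x = a + t then a else x := by
  induction t with
  | zero => intro a x; simp only [cyc, Equiv.Perm.one_apply]; split_ifs <;> omega
  | succ t ih =>
    intro a x
    simp only [cyc, Equiv.Perm.mul_apply, ih, Equiv.swap_apply_def]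
    split_ifs <;> omega

/-- The reversal of the `t` positions `a, a + 1, …, a + t - 1`. -/
def rev : ℕ → ℕ → Equiv.Perm ℕ
  | _, 0 => 1
  | a, t + 1 => cyc a t * rev a t

lemma rev_apply (a t : ℕ) : ∀ x : ℕ, rev a t x =
    if a ≤ x ∧ x < a + t then 2 * a + t - 1 - x else x := by
  induction t with
  | zero => intro x; simp only [rev, Equiv.Perm.one_apply]; split_ifs <;> omega
  | succ t ih =>
    intro x
    simp only [rev, Equiv.Perm.mul_apply, ih, cyc_apply]
    split_ifs <;> omega

lemma rev_one_eq_revPerm (n : ℕ) : rev 1 n = revPerm n := by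
  ext x
  rw [rev_apply]
  change _ = if 1 ≤ x ∧ x ≤ n then n + 1 - x else x
  split_ifs <;> omega

lemma prod_map_swap_range' (t : ℕ) : ∀ a : ℕ,
    ((List.range' a t).map (fun r => Equiv.swap r (r + 1))).prod = cyc a t := by
  induction t with
  | zero => intro a; rfl
  | succ t ih => intro a; simp [List.range'_succ, cyc, ih]

lemma prod_map_swap_reverse_range'_apply (t : ℕ) : ∀ a x : ℕ,
    (((List.range' a t).reverse).map (fun r => Equiv.swap r (r + 1))).prod x =
      if x = a then a + t else if a < x ∧ x ≤ a + t then x - 1 else x := by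
  induction t with
  | zero => intro a x; simp; split_ifs <;> omega
  | succ t ih =>
    intro a x
    simp only [List.range'_succ, List.reverse_cons, List.map_append, List.prod_append,
      Equiv.Perm.mul_apply, ih, List.map_cons, List.map_nil, List.prod_singleton,
      Equiv.swap_apply_def]
    split_ifs <;> omega

lemma wkij_one_apply (n k x : ℕ) (hk : 1 ≤ k) (hkn : k < n) : wkij n 1 k x =
    if x = 1 then n - k + 1 else if 2 ≤ x ∧ x ≤ n - k then x - 1
    else if n - k < x ∧ x < n then x + 1 else if x = n then n - k else x := by
  simp only [wkij, sdesc, sasc, Equiv.Perm.mul_apply, prod_map_swap_range',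
    prod_map_swap_reverse_range'_apply, cyc_apply]
  split_ifs <;> omega

/-- The staircase monomial `x_a^{t-1} x_{a+1}^{t-2} ⋯ x_{a+t-1}^0`. -/
noncomputable def stair : ℕ → ℕ → MvPolynomial ℕ ℤ
  | _, 0 => 1
  | a, t + 1 => X a ^ t * stair (a + 1) t

/-- The monomial `x_a x_{a+1} ⋯ x_{a+l-1}`. -/
noncomputable def prodX : ℕ → ℕ → MvPolynomial ℕ ℤ
  | _, 0 => 1
  | a, l + 1 => X a * prodX (a + 1) l

/-- The elementary symmetric polynomial of degree `j` in `x_a, x_{a+1}, …, x_{a+l-1}`. -/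
noncomputable def elem : ℕ → ℕ → ℕ → MvPolynomial ℕ ℤ
  | 0, _, _ => 1
  | _ + 1, _, 0 => 0
  | j + 1, a, l + 1 => elem (j + 1) (a + 1) l + X a * elem j (a + 1) l

lemma prod_Icc_eq_stair (n : ℕ) :
    ∏ r ∈ Finset.Icc 1 (n - 1), (X r : MvPolynomial ℕ ℤ) ^ (n - r) = stair 1 n := by
  have key : ∀ t a : ℕ, stair a t = ∏ i ∈ Finset.range t, X (a + i) ^ (t - 1 - i) := by
    intro t
    induction t with
    | zero => intro a; simp [stair]
    | succ t ih =>
      intro a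
      rw [stair, ih, Finset.prod_range_succ', mul_comm]
      congr 1
      refine Finset.prod_congr rfl fun i _ => ?_
      rw [show a + 1 + i = a + (i + 1) by omega, show t - 1 - i = t + 1 - 1 - (i + 1) by omega]
  rw [key]
  rcases n with _ | n
  · simp
  · rw [Finset.prod_range_succ]
    simp only [Nat.add_sub_cancel, Nat.sub_self, pow_zero, mul_one]
    rw [← Finset.Ico_add_one_right_eq_Icc, Finset.prod_Ico_eq_prod_range]
    refine Finset.prod_congr (by simp) fun i _ => ?_
    congr 1
    omega

lemma stair_add (m l : ℕ) : ∀ a : ℕ,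
    stair a (l + m) = stair a l * prodX a l ^ m * stair (a + l) m := by
  induction l with
  | zero => intro a; simp [stair, prodX]
  | succ l ih =>
    intro a
    rw [show l + 1 + m = (l + m) + 1 by omega, stair, stair, prodX, ih,
      show a + 1 + l = a + (l + 1) by omega]
    ring

lemma prodX_succ_right (l : ℕ) : ∀ a : ℕ, prodX a (l + 1) = prodX a l * X (a + l) := by
  induction l with
  | zero => intro a; simp [prodX]
  | succ l ih =>
    intro a
    rw [prodX, ih, prodX, show a + 1 + l = a + (l + 1) by omega]
    ring

lemma elem_eq_zero (l : ℕ) : ∀ j a : ℕ, l < j → elem j a l = 0 := by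
  induction l with
  | zero => rintro (_ | j) a h; · omega
            rw [elem]
  | succ l ih =>
    rintro (_ | j) a h
    · omega
    · rw [elem, ih _ _ (by omega), ih _ _ (by omega)]; simp

lemma elem_succ_right (l : ℕ) : ∀ j a : ℕ,
    elem (j + 1) a (l + 1) = elem (j + 1) a l + X (a + l) * elem j a l := by
  induction l with
  | zero => rintro (_ | j) a <;> simp [elem]
  | succ l ih =>
    rintro (_ | j) a
    · have h := ih 0 (a + 1)
      rw [show a + 1 + l = a + (l + 1) by omega] at h
      simp only [elem] at h ⊢
      linear_combination h
    · rw [elem, ih, ih, elem, elem, show a + 1 + l = a + (l + 1) by omega]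
      ring

lemma elem_one_succ (l : ℕ) : elem 1 1 (l + 1) = elem 1 1 l + X (l + 1) := by
  rw [elem_succ_right, add_comm 1 l]; simp [elem]

lemma rename_swap_X_of_ne {r i : ℕ} (h : i ≠ r) (h' : i ≠ r + 1) :
    rename (⇑(Equiv.swap r (r + 1))) (X i : MvPolynomial ℕ ℤ) = X i := by
  rw [rename_X, Equiv.swap_apply_of_ne_of_ne h h']

lemma rename_swap_stair {r : ℕ} (t : ℕ) : ∀ a : ℕ, (r + 1 < a ∨ a + t ≤ r) →
    rename (⇑(Equiv.swap r (r + 1))) (stair a t) = stair a t := by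
  induction t with
  | zero => intro a _; simp [stair]
  | succ t ih =>
    intro a h
    rw [stair, map_mul, map_pow, ih _ (by omega), rename_swap_X_of_ne (by omega) (by omega)]

lemma rename_swap_prodX {r : ℕ} (l : ℕ) : ∀ a : ℕ,
    (r + 1 < a ∨ a + l ≤ r ∨ (a ≤ r ∧ r + 1 < a + l)) →
    rename (⇑(Equiv.swap r (r + 1))) (prodX a l) = prodX a l := by
  induction l with
  | zero => intro a _; simp [prodX]
  | succ l ih =>
    intro a h
    by_cases hr : a = r
    · subst hr
      obtain _ | l := l
      · omega
      · have h2 : rename (⇑(Equiv.swap a (a + 1))) (prodX (a + 1 + 1) l) =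
            prodX (a + 1 + 1) l := by
          have := ih (a + 1 + 1) (by omega)
          rw [prodX_succ_right, map_mul, rename_swap_X_of_ne (by omega) (by omega)] at this
          exact mul_right_cancel₀ (X_ne_zero _) this
        rw [prodX, prodX, map_mul, map_mul, h2, rename_X, rename_X, Equiv.swap_apply_left,
          Equiv.swap_apply_right]
        ring
    · rw [prodX, map_mul, ih _ (by omega), rename_swap_X_of_ne (by omega) (by omega)]

lemma rename_swap_elem_of_notMem {r : ℕ} (l : ℕ) : ∀ j a : ℕ, (r + 1 < a ∨ a + l ≤ r) →
    rename (⇑(Equiv.swap r (r + 1))) (elem j a l) = elem j a l := by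
  induction l with
  | zero => rintro (_ | j) a _ <;> simp [elem]
  | succ l ih =>
    rintro (_ | j) a h
    · simp [elem]
    · rw [elem, map_add, map_mul, ih _ _ (by omega), ih _ _ (by omega),
        rename_swap_X_of_ne (by omega) (by omega)]

lemma rename_swap_elem {r : ℕ} (l : ℕ) : ∀ j a : ℕ, a ≤ r → r + 1 < a + l →
    rename (⇑(Equiv.swap r (r + 1))) (elem j a l) = elem j a l := by
  induction l with
  | zero => rintro j a h h'; omega
  | succ l ih =>
    rintro (_ | j) a h h'
    · simp [elem]
    · by_cases hr : a = r
      · subst hr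
        obtain _ | l := l
        · omega
        · have h2 := fun j => rename_swap_elem_of_notMem (r := a) l j (a + 1 + 1) (by omega)
          obtain _ | j := j <;>
          · simp only [elem, map_add, map_mul, h2, rename_X, Equiv.swap_apply_left,
              Equiv.swap_apply_right, map_one]
            ring
      · rw [elem, map_add, map_mul, ih _ _ (by omega) (by omega), ih _ _ (by omega) (by omega),
          rename_swap_X_of_ne (by omega) (by omega)]

lemma X_mul_elem_sub_rename_swap (r j l : ℕ) :
    X r * elem j (r + 1) (l + 1) -
        X (r + 1) * rename (⇑(Equiv.swap r (r + 1))) (elem j (r + 1) (l + 1)) =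
      (X r - X (r + 1)) * elem j (r + 1 + 1) l := by
  have h := fun j => rename_swap_elem_of_notMem (r := r) l j (r + 1 + 1) (by omega)
  obtain _ | j := j
  · simp [elem]
  · simp only [elem, map_add, map_mul, h, rename_X, Equiv.swap_apply_right]
    ring

/-- `S` satisfies the defining properties of the Schubert polynomials of `S_n`. -/
def IsSchubert (n : ℕ) (S : Equiv.Perm ℕ → MvPolynomial ℕ ℤ) : Prop :=
  S (rev 1 n) = stair 1 n ∧
    ∀ w : Equiv.Perm ℕ, (∀ x, x ∉ Finset.Icc 1 n → w x = x) →
      ∀ r, 1 ≤ r → r < n → w (r + 1) < w r →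
        S w - rename (⇑(Equiv.swap r (r + 1))) (S w)
          = (X r - X (r + 1)) * S (w * Equiv.swap r (r + 1))

section

variable {n : ℕ} {S : Equiv.Perm ℕ → MvPolynomial ℕ ℤ}

/-- Moving a large entry to the right past `t` smaller ones, when the Schubert polynomial is a
staircase times a factor that is controlled at each step. -/
lemma IsSchubert.mul_cyc (hS : IsSchubert n S) (t : ℕ) :
    ∀ (a : ℕ) (w : Equiv.Perm ℕ) (F : ℕ → MvPolynomial ℕ ℤ),
      (∀ x, x ∉ Finset.Icc 1 n → w x = x) → 1 ≤ a → a + t ≤ n →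
      (∀ i, a < i → i ≤ a + t → w i < w a) →
      (∀ s < t, X (a + s) * F s -
          X (a + s + 1) * rename (⇑(Equiv.swap (a + s) (a + s + 1))) (F s) =
        (X (a + s) - X (a + s + 1)) * F (s + 1)) →
      S w = stair a (t + 1) * F 0 → S (w * cyc a t) = stair a t * F t := by
  induction t with
  | zero => intro a w F _ _ _ _ _ h; simpa [cyc, stair] using h
  | succ t ih =>
    intro a w F hw ha hat hlt hF h
    have hstep : S (w * Equiv.swap a (a + 1)) = stair (a + 1) (t + 1) * (X a ^ t * F 1) := by
      have hrec := hS.2 w hw a ha (by omega) (hlt _ (by omega) (by omega))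
      have hne : (X a - X (a + 1) : MvPolynomial ℕ ℤ) ≠ 0 := by
        rw [sub_ne_zero, Ne, X_injective.eq_iff]; omega
      refine mul_left_cancel₀ hne ?_
      rw [← hrec, h]
      have hF0 := hF 0 (by omega)
      simp only [add_zero, zero_add] at hF0
      simp only [stair, map_mul, map_pow, rename_X, Equiv.swap_apply_left,
        Equiv.swap_apply_right, rename_swap_stair (r := a) t (a + 1 + 1) (by omega)]
      linear_combination (X a ^ t * X (a + 1) ^ t * stair (a + 1 + 1) t) * hF0
    have := ih (a + 1) (w * Equiv.swap a (a + 1)) (fun s => X a ^ t * F (s + 1)) ?_ (by omega)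
      (by omega) ?_ ?_ hstep
    · rw [cyc, ← mul_assoc, this, stair]; ring
    · intro x hx
      rw [Equiv.Perm.mul_apply, Equiv.swap_apply_of_ne_of_ne, hw x hx]
      all_goals rintro rfl; simp only [Finset.mem_Icc] at hx; omega
    · intro i hi hi'
      rw [Equiv.Perm.mul_apply, Equiv.Perm.mul_apply, Equiv.swap_apply_right,
        Equiv.swap_apply_of_ne_of_ne (by omega) (by omega)]
      exact hlt i (by omega) (by omega)
    · intro s hs
      have hFs := hF (s + 1) (by omega)
      rw [show a + (s + 1) = a + 1 + s by omega] at hFs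
      simp only [map_mul, map_pow]
      rw [rename_swap_X_of_ne (by omega) (by omega)]
      linear_combination X a ^ t * hFs

/-- Moving a large entry past smaller ones removes one step from a staircase factor. -/
lemma IsSchubert.mul_cyc_of_symm (hS : IsSchubert n S) {t a : ℕ} {w : Equiv.Perm ℕ}
    {F : MvPolynomial ℕ ℤ} (hw : ∀ x, x ∉ Finset.Icc 1 n → w x = x) (ha : 1 ≤ a)
    (hat : a + t ≤ n) (hlt : ∀ i, a < i → i ≤ a + t → w i < w a)
    (hF : ∀ r, a ≤ r → r < a + t → rename (⇑(Equiv.swap r (r + 1))) F = F)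
    (h : S w = stair a (t + 1) * F) : S (w * cyc a t) = stair a t * F := by
  refine hS.mul_cyc t a w (fun _ => F) hw ha hat hlt (fun s hs => ?_) h
  rw [hF _ (by omega) (by omega)]
  ring

/-- Sorting a decreasing block of entries removes a full staircase factor. -/
lemma IsSchubert.mul_rev (hS : IsSchubert n S) {a : ℕ} (ha : 1 ≤ a) (t : ℕ) :
    ∀ (w : Equiv.Perm ℕ) (F : MvPolynomial ℕ ℤ), (∀ x, x ∉ Finset.Icc 1 n → w x = x) →
      a + t ≤ n + 1 → (∀ i j, a ≤ i → i < j → j < a + t → w j < w i) →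
      (∀ r, a ≤ r → r + 1 < a + t → rename (⇑(Equiv.swap r (r + 1))) F = F) →
      S w = stair a t * F → S (w * rev a t) = F := by
  induction t with
  | zero => intro w F _ _ _ _ h; simpa [rev, stair] using h
  | succ t ih =>
    intro w F hw hat hdec hF h
    have hm := hS.mul_cyc_of_symm hw ha (by omega) (fun i hi hi' => hdec a i le_rfl hi (by omega))
      (fun r hr hr' => hF r hr (by omega)) h
    rw [rev, ← mul_assoc]
    refine ih _ F ?_ (by omega) ?_ (fun r hr hr' => hF r hr (by omega)) hm
    · intro x hx
      rw [Equiv.Perm.mul_apply]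
      simp only [Finset.mem_Icc] at hx
      rw [cyc_apply, if_neg (by omega), if_neg (by omega), hw]
      simpa using hx
    · intro i j hi hij hj
      rw [Equiv.Perm.mul_apply, Equiv.Perm.mul_apply, cyc_apply, cyc_apply, if_pos (by omega),
        if_pos (by omega)]
      exact hdec _ _ (by omega) (by omega) (by omega)

/-- Stability: Schubert polynomials of `S_{n+1}` restrict to those of `S_n`. -/
lemma IsSchubert.pred (hS : IsSchubert (n + 1) S) : IsSchubert n S := by
  refine ⟨?_, fun w hw r hr hrn h => hS.2 w (fun x hx => hw x ?_) r hr (by omega) h⟩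
  · have := hS.mul_cyc_of_symm (t := n) (a := 1) (w := rev 1 (n + 1)) (F := 1) ?_ le_rfl
      (by omega) ?_ (by simp) (by rw [hS.1, mul_one])
    · rw [mul_one] at this
      rw [← this]
      congr 1
      ext x
      rw [Equiv.Perm.mul_apply, rev_apply, rev_apply, cyc_apply]
      split_ifs <;> omega
    · intro x hx
      rw [rev_apply, if_neg]
      simp only [Finset.mem_Icc] at hx
      omega
    · intro i hi hi'
      rw [rev_apply, rev_apply, if_pos (by omega), if_pos (by omega)]
      omega
  · simp only [Finset.mem_Icc] at hx ⊢
    omega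

lemma IsSchubert.mono {m : ℕ} (hmn : m ≤ n) (hS : IsSchubert n S) : IsSchubert m S := by
  induction hmn with
  | refl => exact hS
  | step _ ih => exact ih hS.pred

/-- The Schubert polynomial of
`[m+1, …, m+i, m-1, …, 1, m+i+1, …, n, m]`, where `m = t + 1` and `n = m + i + j`. -/
lemma IsSchubert.exists_block (t : ℕ) (j : ℕ) :
    ∀ i : ℕ, IsSchubert (t + 1 + i + j) S → ∃ W : Equiv.Perm ℕ,
      (∀ x, W x = if x = 0 then 0 else if x ≤ i then t + 1 + x
        else if x ≤ i + t then t + 1 + i - x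
        else if x < t + 1 + i + j then x + 1 else if x = t + 1 + i + j then t + 1 else x) ∧
      S W = prodX 1 i ^ (t + 1) * stair (i + 1) t * elem j (i + 1) (t + j) := by
  induction j with
  | zero =>
    intro i hS
    refine ⟨rev 1 (t + 1 + i) * cyc (i + 1) t * rev 1 i, fun x => ?_, ?_⟩
    · simp only [Equiv.Perm.mul_apply, rev_apply, cyc_apply]
      split_ifs <;> omega
    · have h1 : S (rev 1 (t + 1 + i) * cyc (i + 1) t) =
          stair (i + 1) t * (stair 1 i * prodX 1 i ^ (t + 1)) := by
        refine hS.mul_cyc_of_symm ?_ (by omega) (by omega) ?_ ?_ ?_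
        · intro x hx
          simp only [Finset.mem_Icc] at hx
          rw [rev_apply, if_neg (by omega)]
        · intro x hx hx'
          rw [rev_apply, rev_apply, if_pos (by omega), if_pos (by omega)]
          omega
        · intro r hr hr'
          rw [map_mul, map_pow, rename_swap_stair _ _ (by omega),
            rename_swap_prodX _ _ (by omega)]
        · have := hS.1
          simp only [add_zero] at this
          rw [this, add_comm (t + 1) i, stair_add, add_comm 1 i]
          ring
      rw [elem, mul_one]
      refine hS.mul_rev le_rfl i _ _ ?_ (by omega) ?_ ?_ ?_
      · intro x hx
        simp only [Finset.mem_Icc] at hx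
        rw [Equiv.Perm.mul_apply, cyc_apply, if_neg (by omega), if_neg (by omega), rev_apply,
          if_neg (by omega)]
      · intro x y hx hxy hy
        simp only [Equiv.Perm.mul_apply, rev_apply, cyc_apply]
        split_ifs <;> omega
      · intro r hr hr'
        rw [map_mul, map_pow, rename_swap_stair _ _ (by omega),
            rename_swap_prodX _ _ (by omega)]
      · rw [h1]; ring
  | succ j ih =>
    intro i hS
    obtain ⟨W, hW, hSW⟩ := ih (i + 1) (by convert hS using 1; omega)
    refine ⟨W * cyc (i + 1) t, fun x => ?_, ?_⟩
    · simp only [Equiv.Perm.mul_apply, hW, cyc_apply]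
      split_ifs <;> first | omega | contradiction
    · have key := hS.mul_cyc t (i + 1) W (fun s => prodX 1 i ^ (t + 1) *
        (elem (j + 1) (i + 1) (t + (j + 1)) - elem (j + 1) (i + 1 + s + 1) (t + j - s)))
        ?_ (by omega) (by omega) ?_ ?_ ?_
      · rw [key, elem_eq_zero (t + j - t) _ _ (by omega)]
        ring
      · intro x hx
        simp only [Finset.mem_Icc] at hx
        rw [hW]
        split_ifs <;> omega
      · intro x hx hx'
        rw [hW, hW, if_neg (by omega), if_neg (by omega), if_pos (by omega), if_neg (by omega),
          if_pos (by omega)]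
        omega
      · intro s hs
        obtain ⟨l, hl⟩ : ∃ l, t + j - s = l + 1 := ⟨t + j - s - 1, by omega⟩
        have hP := rename_swap_prodX (r := i + 1 + s) i 1 (by omega)
        have hE := rename_swap_elem (r := i + 1 + s) (t + (j + 1)) (j + 1) (i + 1) (by omega)
          (by omega)
        have hL := X_mul_elem_sub_rename_swap (i + 1 + s) (j + 1) l
        rw [hl, show t + j - (s + 1) = l by omega,
          show i + 1 + (s + 1) + 1 = i + 1 + s + 1 + 1 by omega]
        generalize elem (j + 1) (i + 1) (t + (j + 1)) = E at hE ⊢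
        generalize elem (j + 1) (i + 1 + s + 1) (l + 1) = L at hL ⊢
        generalize elem (j + 1) (i + 1 + s + 1 + 1) l = L' at hL ⊢
        rw [map_mul, map_pow, map_sub, hP, hE]
        linear_combination -prodX 1 i ^ (t + 1) * hL
      · rw [hSW, prodX_succ_right, show t + (j + 1) = (t + j) + 1 by omega, elem, stair,
          add_comm 1 i]
        simp only [add_zero, Nat.sub_zero]
        ring

lemma IsSchubert.apply_swap (hn : 2 ≤ n) (hS : IsSchubert n S) :
    S (Equiv.swap (n - 1) n) = elem 1 1 (n - 1) := by
  obtain ⟨t, rfl⟩ : ∃ t, n = t + 1 + 0 + 1 := ⟨n - 2, by omega⟩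
  obtain ⟨W, hW, hSW⟩ := IsSchubert.exists_block t 1 0 hS
  rw [prodX, one_pow, one_mul] at hSW
  have := hS.mul_rev le_rfl t W _ ?_ (by omega) ?_ ?_ hSW
  · rw [show t + 1 + 0 + 1 - 1 = t + 1 by omega, ← this]
    congr 1
    ext x
    simp only [Equiv.Perm.mul_apply, hW, rev_apply, Equiv.swap_apply_def]
    split_ifs <;> omega
  · intro x hx
    simp only [Finset.mem_Icc] at hx
    rw [hW]
    split_ifs <;> omega
  · intro x y hx hxy hy
    rw [hW, hW]
    split_ifs <;> omega
  · intro r hr hr'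
    exact rename_swap_elem _ _ _ (by omega) (by omega)

lemma IsSchubert.apply_wkij {k : ℕ} (hkn : k + 1 < n) (hS : IsSchubert n S) :
    S (wkij n 1 (k + 1)) = X 1 ^ (n - 1 - k) * elem k 2 (n - 2) := by
  obtain ⟨t, rfl⟩ : ∃ t, n = t + 1 + 1 + k := ⟨n - 2 - k, by omega⟩
  obtain ⟨W, hW, hSW⟩ := IsSchubert.exists_block t k 1 hS
  have := hS.mul_rev (a := 2) (by omega) t W (X 1 ^ (t + 1) * elem k 2 (t + k)) ?_ (by omega)
    ?_ ?_ (by rw [hSW, prodX, prodX, mul_one]; ring)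
  · rw [show t + 1 + 1 + k - 1 - k = t + 1 by omega,
      show t + 1 + 1 + k - 2 = t + k by omega, ← this]
    congr 1
    ext x
    rw [wkij_one_apply _ _ _ (by omega) hkn]
    simp only [Equiv.Perm.mul_apply, hW, rev_apply]
    split_ifs <;> omega
  · intro x hx
    simp only [Finset.mem_Icc] at hx
    rw [hW]
    split_ifs <;> omega
  · intro x y hx hxy hy
    rw [hW, hW]
    split_ifs <;> omega
  · intro r hr hr'
    rw [map_mul, map_pow, rename_swap_X_of_ne (by omega) (by omega),
      rename_swap_elem _ _ _ (by omega) (by omega)]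

/-- The alternating sum of the Schubert polynomials of `w_k^{(n,1)}`. -/
lemma IsSchubert.sum_wkij {l : ℕ} (hS : IsSchubert (l + 2) S) :
    ∑ k ∈ Finset.Icc 1 (l + 1), (-1 : MvPolynomial ℕ ℤ) ^ (k - 1) * S (wkij (l + 2) 1 k) =
      ∑ k ∈ Finset.range (l + 1), (-1) ^ k * (X 1 ^ (l + 1 - k) * elem k 2 l) := by
  rw [← Finset.Ico_add_one_right_eq_Icc, Finset.sum_Ico_eq_sum_range]
  refine Finset.sum_congr (by simp) fun k hk => ?_
  simp only [Finset.mem_range] at hk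
  rw [add_comm 1 k, hS.apply_wkij (by omega)]
  simp

end

lemma sum_elem_succ (l : ℕ) :
    ∑ k ∈ Finset.range (l + 2), (-1) ^ k * (X 1 ^ (l + 2 - k) * elem k 2 (l + 1)) =
      (X 1 - X (l + 2)) *
        ∑ k ∈ Finset.range (l + 1), (-1) ^ k * (X 1 ^ (l + 1 - k) * elem k 2 l) := by
  have h1 : X 1 * ∑ k ∈ Finset.range (l + 1), (-1) ^ k * (X 1 ^ (l + 1 - k) * elem k 2 l) =
      ∑ k ∈ Finset.range (l + 2), (-1) ^ k * (X 1 ^ (l + 2 - k) * elem k 2 l) := by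
    rw [Finset.sum_range_succ _ (l + 1), elem_eq_zero l (l + 1) 2 (by omega), mul_zero, mul_zero,
      add_zero, Finset.mul_sum]
    refine Finset.sum_congr rfl fun k hk => ?_
    simp only [Finset.mem_range] at hk
    rw [show l + 2 - k = (l + 1 - k) + 1 by omega]
    ring
  rw [sub_mul, h1, Finset.sum_range_succ' _ (l + 1), Finset.sum_range_succ' _ (l + 1),
    Finset.mul_sum, add_sub_right_comm, ← Finset.sum_sub_distrib]
  congr 1
  swap
  · simp only [elem]
  refine Finset.sum_congr rfl fun k _ => ?_
  rw [elem_succ_right, add_comm 2 l, show l + 2 - (k + 1) = l + 1 - k by omega]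
  ring

/-- equation (3.2) of the paper.  For `n > 2`, in `ℤ[x_1, …, x_n]`:
`(𝔖_{s_1} + 𝔖_{s_{n-2}} - 𝔖_{s_{n-1}}) · (Σ_{k=1}^{n-2} (-1)^{k-1} 𝔖_{w_k^{(n-1,1)}})
  = Σ_{k=1}^{n-1} (-1)^{k-1} 𝔖_{w_k^{(n,1)}}`.
The Schubert polynomials are encoded as any family `S` satisfying their defining
properties (hypotheses `hS0`, `hSrec`). -/
theorem stmt5 (n : ℕ) (hn : 2 < n)
    (S : Equiv.Perm ℕ → MvPolynomial ℕ ℤ)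
    (hS0 : S (revPerm n) = ∏ r ∈ Finset.Icc 1 (n - 1), X r ^ (n - r))
    (hSrec : ∀ w : Equiv.Perm ℕ, (∀ x, x ∉ Finset.Icc 1 n → w x = x) →
      ∀ r, 1 ≤ r → r < n → w (r + 1) < w r →
        S w - rename (⇑(Equiv.swap r (r + 1))) (S w)
          = (X r - X (r + 1)) * S (w * Equiv.swap r (r + 1))) :
    (S (Equiv.swap 1 2) + S (Equiv.swap (n - 2) (n - 1)) - S (Equiv.swap (n - 1) n)) *
        (∑ k ∈ Finset.Icc 1 (n - 2), (-1 : MvPolynomial ℕ ℤ) ^ (k - 1) * S (wkij (n - 1) 1 k))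
      = ∑ k ∈ Finset.Icc 1 (n - 1), (-1 : MvPolynomial ℕ ℤ) ^ (k - 1) * S (wkij n 1 k) := by
  have hS : IsSchubert n S := ⟨by rw [rev_one_eq_revPerm, hS0, prod_Icc_eq_stair], hSrec⟩
  obtain ⟨l, rfl⟩ : ∃ l, n = l + 3 := ⟨n - 3, by omega⟩
  have e1 := (hS.mono (m := 2) (by omega)).apply_swap le_rfl
  have e2 := (hS.mono (m := l + 2) (by omega)).apply_swap (by omega)
  have e3 := hS.apply_swap (by omega)
  have e4 := (hS.mono (m := l + 2) (by omega)).sum_wkij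
  have e5 := hS.sum_wkij (l := l + 1)
  simp only [show l + 3 - 1 = l + 2 by omega, show l + 3 - 2 = l + 1 by omega,
    show l + 2 - 1 = l + 1 by omega, show 2 - 1 = 1 by omega] at e1 e2 e3 ⊢
  rw [e1, e2, e3, e4, e5, sum_elem_succ, elem_one_succ (l + 1)]
  simp only [elem]
  ring
end
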